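/- There is a constant c > 0 such that for every deterministic distributed broadcast algorithm on a multiple-access channel with n nodes and every window size w ≥ 2, there is a window adversary with individual injection rates of window w and an execution of the algorithm against it in which some packet is delayed by at least c · w · max(1, log n / log w) rounds when w ≤ n, and by at least c · (w + n) rounds when w > n. -/

import Mathlib

/-- Feedback that a node may receive from the channel in a round. -/
inductive Feedback (n : ℕ) (M : Type) where
  | heard : Fin n → M → Feedback n M
  | silence : Feedback n M
  | collision : Feedback n M

/-- A deterministic distributed broadcast algorithm for a multiple-access channel
with `n` nodes.  Each node has a set of states with a designated initial state;
from its state and the information whether its FIFO queue is nonempty it decides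
whether to transmit, and which message content to transmit; its deterministic
state transition depends on its previous state, whether its queue was nonempty,
the feedback from the channel, and the number of packets injected into it in the
round. -/
structure Algo (n : ℕ) where
  State : Type
  Msg : Type
  init : Fin n → State
  send : Fin n → State → Bool → Bool
  msg : Fin n → State → Msg
  next : Fin n → State → Bool → Feedback n Msg → ℕ → State

/-- An execution of an algorithm against the injection pattern `a`
(`a t i` is the number of packets injected into node `i` in round `t`);
`cd` records whether the channel is with collision detection. -/
structure Exec {n : ℕ} (A : Algo n) (cd : Bool) (a : ℕ → Fin n → ℕ) where
  state : ℕ → Fin n → A.State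
  queue : ℕ → Fin n → ℕ

namespace Exec

variable {n : ℕ} {A : Algo n} {cd : Bool} {a : ℕ → Fin n → ℕ}

/-- Node `i` transmits in round `t`. -/
def transmits (E : Exec A cd a) (t : ℕ) (i : Fin n) : Bool :=
  A.send i (E.state t i) (decide (0 < E.queue t i))

/-- The set of nodes transmitting in round `t`. -/
def transmitters (E : Exec A cd a) (t : ℕ) : Finset (Fin n) :=
  Finset.univ.filter fun i => E.transmits t i = true

/-- The feedback delivered by the channel in round `t`: if exactly one node
transmits then its message is heard by every node; with no transmitters the
round is silent; with at least two transmitters a collision occurs, which is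
perceived as silence when the channel is without collision detection. -/
noncomputable def feedback (E : Exec A cd a) (t : ℕ) : Feedback n A.Msg :=
  if h : ∃ i, E.transmitters t = {i} then
    Feedback.heard h.choose (A.msg h.choose (E.state t h.choose))
  else if E.transmitters t = ∅ then Feedback.silence
  else if cd then Feedback.collision else Feedback.silence

/-- A packet (from node `i`) is heard in round `t`: node `i` is the unique
transmitter in round `t` and it has a packet (the head of its FIFO queue). -/
def PacketHeard (E : Exec A cd a) (t : ℕ) (i : Fin n) : Prop :=
  E.transmitters t = {i} ∧ 0 < E.queue t i

instance (E : Exec A cd a) (t : ℕ) (i : Fin n) : Decidable (E.PacketHeard t i) := by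
  unfold PacketHeard; infer_instance

/-- The execution obeys the dynamics: initial states and empty initial queues;
states evolve by the algorithm's transition function; a queue grows by the
injected packets and loses a packet exactly when this packet is heard. -/
def Valid (E : Exec A cd a) : Prop :=
  (∀ i, E.state 0 i = A.init i) ∧
  (∀ i, E.queue 0 i = 0) ∧
  (∀ t i, E.state (t + 1) i =
      A.next i (E.state t i) (decide (0 < E.queue t i)) (E.feedback t) (a t i)) ∧
  (∀ t i, E.queue (t + 1) i =
      E.queue t i + a t i - (if E.PacketHeard t i then 1 else 0))

/-- The number of packets of node `i` heard in rounds `0, …, t-1`. -/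
def heardCum (E : Exec A cd a) (i : Fin n) (t : ℕ) : ℕ :=
  ((Finset.range t).filter fun u => E.PacketHeard u i).card

/-- The total number of packets stored in queues at round `t`. -/
def totalQueue (E : Exec A cd a) (t : ℕ) : ℕ := ∑ i, E.queue t i

end Exec

/-- The number of packets injected into node `i` in rounds `0, …, t-1`. -/
def injCum {n : ℕ} (a : ℕ → Fin n → ℕ) (i : Fin n) (t : ℕ) : ℕ :=
  ∑ u ∈ Finset.range t, a u i

/-- `a` is an injection pattern allowed for a window adversary with individual
injection rates, of window size `w` and shares `s`: in every interval of `w`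
consecutive rounds, at most `s i` packets are injected into node `i`. -/
def Conforms {n : ℕ} (a : ℕ → Fin n → ℕ) (w : ℕ) (s : Fin n → ℕ) : Prop :=
  ∀ (i : Fin n) (t : ℕ), ∑ u ∈ Finset.Ico t (t + w), a u i ≤ s i

/-- A non-adaptive algorithm: a transmitted message consists of a packet only,
with no control bits (so the content of a message carries no information), and
a node cannot transmit a message when it has no packet. -/
def Algo.NonAdaptive {n : ℕ} (A : Algo n) : Prop :=
  (∀ i s s', A.msg i s = A.msg i s') ∧ (∀ i s, A.send i s false = false)

/-- An acknowledgment-based algorithm: a node without packets to transmit stays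
in its initial state, and a node resets its state to the initial state
immediately after a successful transmission. -/
def Algo.AckBased {n : ℕ} (A : Algo n) : Prop :=
  (∀ i s fb, A.next i s false fb 0 = A.init i) ∧
  (∀ i s q fb k, (∃ m, fb = Feedback.heard i m) → A.next i s q fb k = A.init i)

/-- A conflict-free algorithm: in any execution, at most one node transmits in
each round. -/
def Algo.ConflictFree {n : ℕ} (A : Algo n) : Prop :=
  ∀ (cd : Bool) (a : ℕ → Fin n → ℕ) (E : Exec A cd a), E.Valid →
    ∀ t, (E.transmitters t).card ≤ 1

/-- Every packet is heard within `L` rounds of its injection: for each node `i`,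
all packets injected into `i` in rounds `0, …, r` are heard by round `r + L`
(FIFO counting formulation). -/
def Exec.LatencyBound {n : ℕ} {A : Algo n} {cd : Bool} {a : ℕ → Fin n → ℕ}
    (E : Exec A cd a) (L : ℕ) : Prop :=
  ∀ (i : Fin n) (r : ℕ), injCum a i (r + 1) ≤ E.heardCum i (r + L + 1)

/-- Some packet is delayed by at least `D` rounds: for some node `i` and round
`r`, fewer packets of node `i` are heard in rounds `0, …, r + D - 1` than were
injected into `i` in rounds `0, …, r`, so some packet injected by round `r`
spends at least `D` rounds in the queue. -/
def Exec.DelayAtLeast {n : ℕ} {A : Algo n} {cd : Bool} {a : ℕ → Fin n → ℕ}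
    (E : Exec A cd a) (D : ℕ) : Prop :=
  ∃ (i : Fin n) (r : ℕ), E.heardCum i (r + D) < injCum a i (r + 1)

/-- The number of packets stored in queues grows without bound. -/
def Exec.UnboundedQueues {n : ℕ} {A : Algo n} {cd : Bool} {a : ℕ → Fin n → ℕ}
    (E : Exec A cd a) : Prop :=
  ∀ B : ℕ, ∃ t, B < E.totalQueue t

namespace Exec

variable {n : ℕ} {A : Algo n} {cd : Bool}

theorem mem_transmitters {a : ℕ → Fin n → ℕ} (E : Exec A cd a) {t : ℕ} {i : Fin n} :
    i ∈ E.transmitters t ↔ A.send i (E.state t i) (decide (0 < E.queue t i)) = true :=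
  Finset.mem_filter_univ i

theorem feedback_of_transmitters_eq_singleton {a : ℕ → Fin n → ℕ} (E : Exec A cd a) {t : ℕ}
    {i : Fin n} (h : E.transmitters t = {i}) :
    E.feedback t = Feedback.heard i (A.msg i (E.state t i)) := by
  have hex : ∃ j, E.transmitters t = {j} := ⟨i, h⟩
  have hi : hex.choose = i := Finset.singleton_injective (hex.choose_spec.symm.trans h)
  rw [feedback, dif_pos hex, hi]

theorem feedback_of_transmitters_eq_empty {a : ℕ → Fin n → ℕ} (E : Exec A cd a) {t : ℕ}
    (h : E.transmitters t = ∅) : E.feedback t = Feedback.silence := by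
  simp [feedback, h]

theorem feedback_of_two_le_card_transmitters {a : ℕ → Fin n → ℕ} (E : Exec A cd a) {t : ℕ}
    (h : 2 ≤ (E.transmitters t).card) :
    E.feedback t = if cd then Feedback.collision else Feedback.silence := by
  have h1 : ¬ ∃ j, E.transmitters t = {j} := by
    rintro ⟨j, hj⟩
    simp [hj] at h
  have h0 : E.transmitters t ≠ ∅ := by
    intro h0
    simp [h0] at h
  rw [feedback, dif_neg h1, if_neg h0]

theorem transmitters_eq_singleton_iff {a : ℕ → Fin n → ℕ} (E : Exec A cd a) {t : ℕ} {i : Fin n} :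
    E.transmitters t = {i} ↔ ∃ x, E.feedback t = Feedback.heard i x := by
  refine ⟨fun h => ⟨_, E.feedback_of_transmitters_eq_singleton h⟩, ?_⟩
  rintro ⟨x, hx⟩
  by_cases h : ∃ j, E.transmitters t = {j}
  · obtain ⟨j, hj⟩ := h
    rw [E.feedback_of_transmitters_eq_singleton hj] at hx
    rw [hj, (Feedback.heard.inj hx).1]
  · rw [feedback, dif_neg h] at hx
    split_ifs at hx

/-- The configuration reached at the start of each round. -/
noncomputable def config (A : Algo n) (cd : Bool) (a : ℕ → Fin n → ℕ) :
    ℕ → (Fin n → A.State) × (Fin n → ℕ)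
  | 0 => (A.init, 0)
  | t + 1 =>
    let c := config A cd a t
    let E : Exec A cd a := ⟨fun _ => c.1, fun _ => c.2⟩
    (fun i => A.next i (c.1 i) (decide (0 < c.2 i)) (E.feedback t) (a t i),
      fun i => c.2 i + a t i - (if E.PacketHeard t i then 1 else 0))

/-- The execution of an algorithm against an injection pattern. -/
noncomputable def run (A : Algo n) (cd : Bool) (a : ℕ → Fin n → ℕ) : Exec A cd a where
  state t := (config A cd a t).1
  queue t := (config A cd a t).2

theorem run_valid (A : Algo n) (cd : Bool) (a : ℕ → Fin n → ℕ) : (run A cd a).Valid :=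
  ⟨fun _ => rfl, fun _ => rfl, fun _ _ => rfl, fun _ _ => rfl⟩

/-- A node that receives the same injections and hears the same feedback in two executions
behaves in the same way in both. -/
theorem Valid.local_eq {a a' : ℕ → Fin n → ℕ} {E : Exec A cd a} {E' : Exec A cd a'}
    (hE : E.Valid) (hE' : E'.Valid) {i : Fin n} (ha : ∀ u, a u i = a' u i) {t : ℕ}
    (hf : ∀ u < t, E.feedback u = E'.feedback u) :
    E.state t i = E'.state t i ∧ E.queue t i = E'.queue t i := by
  induction t with
  | zero => exact ⟨by rw [hE.1, hE'.1], by rw [hE.2.1, hE'.2.1]⟩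
  | succ t ih =>
    obtain ⟨hs, hq⟩ := ih fun u hu => hf u (hu.trans t.lt_succ_self)
    have hft := hf t t.lt_succ_self
    have hp : E.PacketHeard t i ↔ E'.PacketHeard t i := by
      rw [PacketHeard, PacketHeard, transmitters_eq_singleton_iff, transmitters_eq_singleton_iff,
        hft, hq]
    constructor
    · rw [hE.2.2.1, hE'.2.2.1, hs, hq, hft, ha]
    · rw [hE.2.2.2, hE'.2.2.2, hq, ha]
      simp only [hp]

theorem Valid.heardCum_le {a : ℕ → Fin n → ℕ} {E : Exec A cd a} (hE : E.Valid) (i : Fin n)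
    (t : ℕ) : E.heardCum i t ≤ t - 1 := by
  have hsub : (Finset.range t).filter (fun u => E.PacketHeard u i) ⊆ Finset.Ico 1 t := by
    intro u hu
    simp only [Finset.mem_filter, Finset.mem_range, Finset.mem_Ico] at hu ⊢
    refine ⟨Nat.one_le_iff_ne_zero.2 ?_, hu.1⟩
    rintro rfl
    have := hu.2.2
    rw [hE.2.1] at this
    exact this.false
  simpa [heardCum] using Finset.card_le_card hsub

end Exec

/-- The injection pattern in which all packets are injected in round `0`. -/
def burst {n : ℕ} (s : Fin n → ℕ) (t : ℕ) (i : Fin n) : ℕ := if t = 0 then s i else 0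

theorem conforms_burst {n : ℕ} (s : Fin n → ℕ) (w : ℕ) : Conforms (burst s) w s := by
  intro i t
  simp only [burst, Finset.sum_ite_eq']
  split_ifs <;> simp

theorem injCum_burst_one {n : ℕ} (s : Fin n → ℕ) (i : Fin n) : injCum (burst s) i 1 = s i := by
  simp [injCum, burst]

/-- The nodes that a choice of subsets makes active. -/
def activeSet {n m : ℕ} (p : Fin m → Finset (Fin n)) : Finset (Fin n) := Finset.univ.biUnion p

/-- `p` selects a pair of nodes from each of the candidate sets `V j`. -/
def SelectsPairs {n m : ℕ} (V p : Fin m → Finset (Fin n)) : Prop :=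
  ∀ j, p j ⊆ V j ∧ (p j).card = 2

theorem SelectsPairs.mono {n m : ℕ} {V V' p : Fin m → Finset (Fin n)} (h : SelectsPairs V' p)
    (hV : ∀ j, V' j ⊆ V j) : SelectsPairs V p :=
  fun j => ⟨(h j).1.trans (hV j), (h j).2⟩

theorem SelectsPairs.card_activeSet_le {n m : ℕ} {V p : Fin m → Finset (Fin n)}
    (h : SelectsPairs V p) : (activeSet p).card ≤ 2 * m := by
  refine Finset.card_biUnion_le.trans ?_
  simp [(h _).2, mul_comm]

theorem subset_activeSet {n m : ℕ} (p : Fin m → Finset (Fin n)) (j : Fin m) :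
    p j ⊆ activeSet p :=
  Finset.subset_biUnion_of_mem p (Finset.mem_univ j)

theorem exists_selectsPairs {n m : ℕ} {V : Fin m → Finset (Fin n)} (hV : ∀ j, 2 ≤ (V j).card) :
    ∃ p, SelectsPairs V p := by
  choose p hp using fun j => Finset.exists_subset_card_eq (hV j)
  exact ⟨p, hp⟩

theorem prod_le_two_mul_prod {m : ℕ} (hm : 1 ≤ m) {f g : Fin m → ℕ}
    (h : ∀ j, (2 * m - 1) * f j ≤ 2 * m * g j) : ∏ j, f j ≤ 2 * ∏ j, g j := by
  have hm' : (1 : ℝ) ≤ m := by exact_mod_cast hm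
  have hfac : (0 : ℝ) ≤ 1 + -(1 / (2 * m)) := by
    have : 1 / (2 * (m : ℝ)) ≤ 1 := by
      rw [div_le_one (by positivity)]
      linarith
    linarith
  have hprod : ∏ j, ((1 + -(1 / (2 * m : ℝ))) * f j) ≤ ∏ j, (g j : ℝ) := by
    refine Finset.prod_le_prod (fun j _ => by positivity) fun j _ => ?_
    have hj : ((2 * m - 1 : ℕ) : ℝ) * f j ≤ 2 * m * g j := by exact_mod_cast h j
    rw [Nat.cast_sub (by omega)] at hj
    push_cast at hj
    have : (1 + -(1 / (2 * m : ℝ))) * f j = ((2 * m - 1) * f j) / (2 * m) := by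
      field_simp
      ring
    rw [this, div_le_iff₀ (by positivity)]
    linarith
  rw [Finset.prod_mul_distrib, Finset.prod_const, Finset.card_univ, Fintype.card_fin] at hprod
  have hbern : (1 / 2 : ℝ) ≤ (1 + -(1 / (2 * m : ℝ))) ^ m := by
    refine le_trans (le_of_eq ?_) (one_add_mul_le_pow (by linarith) m)
    field_simp
    ring
  have hpos : (0 : ℝ) ≤ ∏ j, (f j : ℝ) := by positivity
  have : ∏ j, (f j : ℝ) ≤ 2 * ∏ j, (g j : ℝ) := by nlinarith
  exact_mod_cast this

/-- Suppose that the nodes in `A` transmit when active and the nodes in `B` transmit when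
inactive.  The candidate sets can be shrunk, at a small multiplicative cost, so that either a
collision always occurs, or the activity of each transmitting node is determined. -/
theorem exists_refinement {n m : ℕ} (hm : 1 ≤ m) (V : Fin m → Finset (Fin n))
    (hV : ∀ j, 2 ≤ (V j).card) (A B : Finset (Fin n)) :
    ∃ V' : Fin m → Finset (Fin n), (∀ j, V' j ⊆ V j) ∧ (∀ j, 2 ≤ (V' j).card) ∧
      ∏ j, max (V j).card (16 * m ^ 2) ≤ 4 * m * ∏ j, max (V' j).card (16 * m ^ 2) ∧
      ((∀ p, SelectsPairs V' p →
          2 ≤ ((activeSet p ∩ A) ∪ (B \ activeSet p)).card) ∨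
        ∀ p p', SelectsPairs V' p → SelectsPairs V' p' →
          ∀ i ∈ (activeSet p ∩ A) ∪ (B \ activeSet p), (i ∈ activeSet p ↔ i ∈ activeSet p')) := by
  by_cases hB : 2 * m + 2 ≤ B.card
  · refine ⟨V, fun _ => subset_rfl, hV, Nat.le_mul_of_pos_left _ (by omega), Or.inl ?_⟩
    intro p hp
    have h1 := Finset.le_card_sdiff (activeSet p) B
    have h2 := hp.card_activeSet_le
    refine le_trans ?_ (Finset.card_le_card Finset.subset_union_right)
    omega
  by_cases hA : ∃ j, 16 * m ^ 2 ≤ (V j).card ∧ (V j).card ≤ 4 * m * (V j ∩ A).card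
  · obtain ⟨j, hj, hjA⟩ := hA
    refine ⟨Function.update V j (V j ∩ A), ?_, ?_, ?_, Or.inl ?_⟩
    · intro l
      by_cases hl : l = j
      · subst hl
        simp [Finset.inter_subset_left]
      · simp [hl]
    · intro l
      by_cases hl : l = j
      · subst hl
        simp only [Function.update_self]
        by_contra hlt
        nlinarith
      · simp [hl, hV]
    · rw [← Finset.mul_prod_erase _ _ (Finset.mem_univ j),
        ← Finset.mul_prod_erase (a := j) _
          (fun l => max (Function.update V j (V j ∩ A) l).card (16 * m ^ 2)) (Finset.mem_univ j),
        ← mul_assoc]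
      refine Nat.mul_le_mul ?_ (le_of_eq (Finset.prod_congr rfl fun l hl => ?_))
      · rw [Function.update_self, max_eq_left hj]
        exact hjA.trans (Nat.mul_le_mul_left _ (le_max_left _ _))
      · rw [Function.update_of_ne (Finset.ne_of_mem_erase hl)]
    · intro p hp
      have hpj := hp j
      rw [Function.update_self] at hpj
      rw [← hpj.2]
      refine Finset.card_le_card (Finset.Subset.trans ?_ Finset.subset_union_left)
      exact Finset.subset_inter (subset_activeSet p j)
        (hpj.1.trans Finset.inter_subset_right)
  push Not at hA hB
  obtain ⟨q, hq⟩ := exists_selectsPairs hV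
  have hcard : ∀ j, 16 * m ^ 2 ≤ (V j).card →
      (2 * m - 1) * (V j).card ≤ 2 * m * (V j \ (A ∪ B)).card ∧
        2 ≤ (V j \ (A ∪ B)).card := by
    intro j hj
    have hjA := hA j hj
    have hsplit : (V j).card ≤ (V j \ (A ∪ B)).card + (V j ∩ A).card + B.card := by
      have h1 := Finset.card_sdiff_add_card_inter (V j) (A ∪ B)
      have h2 : (V j ∩ (A ∪ B)).card ≤ (V j ∩ A).card + B.card := by
        rw [Finset.inter_union_distrib_left]
        refine (Finset.card_union_le _ _).trans ?_
        gcongr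
        exact Finset.inter_subset_right
      omega
    have hmain : (2 * m - 1) * (V j).card ≤ 2 * m * (V j \ (A ∪ B)).card := by
      obtain ⟨k, rfl⟩ : ∃ k, m = k + 1 := ⟨m - 1, by omega⟩
      rw [show 2 * (k + 1) - 1 = 2 * k + 1 by omega]
      nlinarith
    refine ⟨hmain, ?_⟩
    by_contra hlt
    have h2 : 2 * m * (V j \ (A ∪ B)).card ≤ 2 * m * 1 := Nat.mul_le_mul_left _ (by omega)
    have h3 : 1 * (V j).card ≤ (2 * m - 1) * (V j).card := Nat.mul_le_mul_right _ (by omega)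
    nlinarith
  refine ⟨fun j => if 16 * m ^ 2 ≤ (V j).card then V j \ (A ∪ B) else q j, ?_, ?_, ?_, Or.inr ?_⟩
  · intro j
    dsimp only
    split_ifs
    · exact Finset.sdiff_subset
    · exact (hq j).1
  · intro j
    dsimp only
    split_ifs with hj
    · exact (hcard j hj).2
    · exact (hq j).2.ge
  · refine (prod_le_two_mul_prod hm fun j => ?_).trans (Nat.mul_le_mul_right _ (by omega))
    dsimp only
    split_ifs with hj
    · rw [max_eq_left hj]
      exact (hcard j hj).1.trans (Nat.mul_le_mul_left _ (le_max_left _ _))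
    · rw [max_eq_right (by omega)]
      exact Nat.mul_le_mul (by omega) (le_max_right _ _)
  · have key : ∀ p p' : Fin m → Finset (Fin n),
        SelectsPairs (fun j => if 16 * m ^ 2 ≤ (V j).card then V j \ (A ∪ B) else q j) p →
        SelectsPairs (fun j => if 16 * m ^ 2 ≤ (V j).card then V j \ (A ∪ B) else q j) p' →
        ∀ i ∈ A ∪ B, i ∈ activeSet p → i ∈ activeSet p' := by
      intro p p' hp hp' i hi hip
      obtain ⟨j, -, hij⟩ := Finset.mem_biUnion.1 hip
      have h1 := hp j
      have h2 := hp' j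
      dsimp only at h1 h2
      split_ifs at h1 h2 with hj
      · exact absurd hi (Finset.mem_sdiff.1 (h1.1 hij)).2
      · have e1 := Finset.eq_of_subset_of_card_le h1.1 ((hq j).2.trans h1.2.symm).le
        have e2 := Finset.eq_of_subset_of_card_le h2.1 ((hq j).2.trans h2.2.symm).le
        exact subset_activeSet p' j (by rwa [e2, ← e1])
    intro p p' hp hp' i hi
    have hi' : i ∈ A ∪ B := by
      simp only [Finset.mem_union, Finset.mem_inter, Finset.mem_sdiff] at hi ⊢
      tauto
    exact ⟨key p p' hp hp' i hi', key p' p hp' hp i hi'⟩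

/-- The execution in which each node in `S` has a packet injected in round `0`. -/
noncomputable def burstRun {n : ℕ} (A : Algo n) (cd : Bool) (S : Finset (Fin n)) :
    Exec A cd (burst fun i => if i ∈ S then 1 else 0) :=
  Exec.run A cd _

/-- In rounds before `t`, all selections from the candidate sets `V` produce the same feedback,
and only nodes whose activity is determined by `V` are heard. -/
def Indistinguishable {n m : ℕ} (A : Algo n) (cd : Bool) (V : Fin m → Finset (Fin n))
    (t : ℕ) : Prop :=
  ∀ p p', SelectsPairs V p → SelectsPairs V p' → ∀ u < t,
    (burstRun A cd (activeSet p)).feedback u = (burstRun A cd (activeSet p')).feedback u ∧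
    ∀ i, (burstRun A cd (activeSet p)).transmitters u = {i} →
      i ∈ activeSet p → i ∈ activeSet p'

theorem Indistinguishable.local_eq {n m : ℕ} {A : Algo n} {cd : Bool} {V : Fin m → Finset (Fin n)}
    {t : ℕ} (h : Indistinguishable A cd V t) {p p' : Fin m → Finset (Fin n)}
    (hp : SelectsPairs V p) (hp' : SelectsPairs V p') {i : Fin n}
    (hi : i ∈ activeSet p ↔ i ∈ activeSet p') :
    (burstRun A cd (activeSet p)).state t i = (burstRun A cd (activeSet p')).state t i ∧
      (burstRun A cd (activeSet p)).queue t i = (burstRun A cd (activeSet p')).queue t i :=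
  Exec.Valid.local_eq (Exec.run_valid _ _ _) (Exec.run_valid _ _ _)
    (fun u => by simp only [burst, hi]) fun u hu => (h p p' hp hp' u hu).1

theorem Indistinguishable.exists_succ {n m : ℕ} {A : Algo n} {cd : Bool}
    {V : Fin m → Finset (Fin n)} {t : ℕ} (h : Indistinguishable A cd V t) (hm : 1 ≤ m)
    (hV : ∀ j, 2 ≤ (V j).card) :
    ∃ V' : Fin m → Finset (Fin n), (∀ j, 2 ≤ (V' j).card) ∧
      ∏ j, max (V j).card (16 * m ^ 2) ≤ 4 * m * ∏ j, max (V' j).card (16 * m ^ 2) ∧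
      Indistinguishable A cd V' (t + 1) := by
  classical
  let P : Finset (Fin n) := Finset.univ.filter fun i =>
    ∃ p, SelectsPairs V p ∧ i ∈ activeSet p ∧ i ∈ (burstRun A cd (activeSet p)).transmitters t
  let Q : Finset (Fin n) := Finset.univ.filter fun i =>
    ∃ p, SelectsPairs V p ∧ i ∉ activeSet p ∧ i ∈ (burstRun A cd (activeSet p)).transmitters t
  have htr : ∀ p p', SelectsPairs V p → SelectsPairs V p' → ∀ i,
      (i ∈ activeSet p ↔ i ∈ activeSet p') →
      i ∈ (burstRun A cd (activeSet p)).transmitters t →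
      i ∈ (burstRun A cd (activeSet p')).transmitters t := by
    intro p p' hp hp' i hi hit
    obtain ⟨hs, hq⟩ := h.local_eq hp hp' hi
    rw [Exec.mem_transmitters] at hit ⊢
    rwa [← hs, ← hq]
  have hT : ∀ p, SelectsPairs V p → (burstRun A cd (activeSet p)).transmitters t =
      (activeSet p ∩ P) ∪ (Q \ activeSet p) := by
    intro p hp
    ext i
    simp only [Finset.mem_union, Finset.mem_inter, Finset.mem_sdiff, P, Q, Finset.mem_filter,
      Finset.mem_univ, true_and]
    constructor
    · intro hi
      by_cases hip : i ∈ activeSet p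
      · exact Or.inl ⟨hip, p, hp, hip, hi⟩
      · exact Or.inr ⟨⟨p, hp, hip, hi⟩, hip⟩
    · rintro (⟨hip, p', hp', hip', hi⟩ | ⟨⟨p', hp', hip', hi⟩, hip⟩)
      · exact htr p' p hp' hp i (iff_of_true hip' hip) hi
      · exact htr p' p hp' hp i (iff_of_false hip' hip) hi
  obtain ⟨V', hsub, hV', hprod, hcases⟩ := exists_refinement hm V hV P Q
  refine ⟨V', hV', hprod, ?_⟩
  intro p p' hp hp' u hu
  have hpV := hp.mono hsub
  have hpV' := hp'.mono hsub
  rcases Nat.lt_succ_iff_lt_or_eq.1 hu with hu | rfl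
  · exact h p p' hpV hpV' u hu
  rcases hcases with hcol | hdet
  · have h1 := hcol p hp
    have h2 := hcol p' hp'
    rw [← hT p hpV] at h1
    rw [← hT p' hpV'] at h2
    refine ⟨by rw [Exec.feedback_of_two_le_card_transmitters _ h1,
      Exec.feedback_of_two_le_card_transmitters _ h2], fun i hi => ?_⟩
    simp [hi] at h1
  · have h1 := hdet p p' hp hp'
    have h2 := hdet p' p hp' hp
    rw [← hT p hpV] at h1
    rw [← hT p' hpV'] at h2
    have heq : (burstRun A cd (activeSet p)).transmitters u =
        (burstRun A cd (activeSet p')).transmitters u :=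
      Finset.Subset.antisymm (fun i hi => htr p p' hpV hpV' i (h1 i hi) hi)
        (fun i hi => htr p' p hpV' hpV i (h2 i hi) hi)
    refine ⟨?_, fun i hi => (h1 i (by simp [hi])).1⟩
    by_cases hc : 2 ≤ ((burstRun A cd (activeSet p)).transmitters u).card
    · rw [Exec.feedback_of_two_le_card_transmitters _ hc,
        Exec.feedback_of_two_le_card_transmitters _ (heq ▸ hc)]
    · rcases Finset.eq_empty_or_nonempty ((burstRun A cd (activeSet p)).transmitters u)
        with h0 | ⟨i, hi⟩
      · rw [Exec.feedback_of_transmitters_eq_empty _ h0,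
          Exec.feedback_of_transmitters_eq_empty _ (heq ▸ h0)]
      · have hs : (burstRun A cd (activeSet p)).transmitters u = {i} :=
          Finset.eq_singleton_iff_unique_mem.2
            ⟨hi, fun x hx => Finset.card_le_one.1 (by omega) x hx i hi⟩
        rw [Exec.feedback_of_transmitters_eq_singleton _ hs,
          Exec.feedback_of_transmitters_eq_singleton _ (heq ▸ hs),
          (h.local_eq hpV hpV' (h1 i hi)).1]

theorem exists_indistinguishable {n m : ℕ} (A : Algo n) (cd : Bool) (hm : 1 ≤ m) (hn : 2 ≤ n)
    (t : ℕ) :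
    ∃ V : Fin m → Finset (Fin n), (∀ j, 2 ≤ (V j).card) ∧
      n ^ m ≤ (4 * m) ^ t * ∏ j, max (V j).card (16 * m ^ 2) ∧ Indistinguishable A cd V t := by
  induction t with
  | zero =>
    refine ⟨fun _ => Finset.univ, fun _ => by simpa using hn, ?_, fun _ _ _ _ u hu => absurd hu u.not_lt_zero⟩
    simp only [Finset.card_univ, Fintype.card_fin, Finset.prod_const, pow_zero, one_mul]
    exact Nat.pow_le_pow_left (le_max_left _ _) _
  | succ t ih =>
    obtain ⟨V, hV, hprod, hind⟩ := ih
    obtain ⟨V', hV', hprod', hind'⟩ := hind.exists_succ hm hV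
    refine ⟨V', hV', hprod.trans ?_, hind'⟩
    rw [pow_succ (4 * m), mul_assoc]
    exact Nat.mul_le_mul_left _ hprod'

/-- A burst of one packet into each of at most `2 m` suitable nodes is not cleared in `t` rounds
unless `t` is large. -/
theorem exists_burst_delayAtLeast {n m t : ℕ} (A : Algo n) (cd : Bool) (hm : 1 ≤ m) (hn : 2 ≤ n)
    (ht : (4 * m) ^ t * (16 * m ^ 2) ^ m < n ^ m) :
    ∃ S : Finset (Fin n), S.card ≤ 2 * m ∧ (burstRun A cd S).DelayAtLeast t := by
  obtain ⟨V, hV, hprod, hind⟩ := exists_indistinguishable A cd hm hn t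
  obtain ⟨j, hj⟩ : ∃ j, 16 * m ^ 2 < (V j).card := by
    by_contra! hcon
    refine (hprod.trans_lt' ht).ne ?_
    simp [max_eq_right (hcon _)]
  obtain ⟨p', hp'⟩ := exists_selectsPairs hV
  obtain ⟨x, hxV, hx⟩ : ∃ x ∈ V j, x ∉ activeSet p' := by
    refine Finset.exists_mem_notMem_of_card_lt_card ?_
    have := hp'.card_activeSet_le
    nlinarith
  obtain ⟨r, hxr, hrV, hr⟩ := Finset.exists_subsuperset_card_eq
    (Finset.singleton_subset_iff.2 hxV) (by simp) (hV j)
  have hp : SelectsPairs V (Function.update p' j r) := by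
    intro l
    by_cases hl : l = j
    · subst hl
      simpa using ⟨hrV, hr⟩
    · simpa [hl] using hp' l
  have hxp : x ∈ activeSet (Function.update p' j r) :=
    subset_activeSet _ j (by simpa using hxr)
  refine ⟨activeSet (Function.update p' j r), hp.card_activeSet_le, x, 0, ?_⟩
  rw [zero_add, zero_add, injCum_burst_one, if_pos hxp, Nat.lt_one_iff, Exec.heardCum,
    Finset.card_eq_zero, Finset.filter_eq_empty_iff]
  intro u hu hheard
  exact hx ((hind _ p' hp hp' u (Finset.mem_range.1 hu)).2 x hheard.1 hxp)

theorem pow_mul_pow_lt_of_log {n m w t : ℕ} (hw : 2 ≤ w) (hmw : 2 * m ≤ w)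
    (hn : 1 ≤ n) (h : ((2 * t + 4 * m : ℕ) : ℝ) * Real.log w < m * Real.log n) :
    (4 * m) ^ t * (16 * m ^ 2) ^ m < n ^ m := by
  have h1 : 4 * m ≤ w ^ 2 := by nlinarith
  have h2 : 16 * m ^ 2 ≤ w ^ 4 := by nlinarith [Nat.pow_le_pow_left h1 2]
  have h3 : (4 * m) ^ t * (16 * m ^ 2) ^ m ≤ w ^ (2 * t + 4 * m) := by
    rw [pow_add, pow_mul, pow_mul w 4 m]
    exact Nat.mul_le_mul (Nat.pow_le_pow_left h1 t) (Nat.pow_le_pow_left h2 m)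
  refine h3.trans_lt ?_
  have h4 : ((w : ℝ)) ^ (2 * t + 4 * m) < (n : ℝ) ^ m := by
    refine (Real.log_lt_log_iff (by positivity) (by positivity)).1 ?_
    rwa [Real.log_pow, Real.log_pow]
  exact_mod_cast h4

/-- A burst of `w` packets into a single node gives delay at least `w`. -/
theorem exists_delayAtLeast_window {n : ℕ} (hn : 1 ≤ n) (A : Algo n) (cd : Bool) {w : ℕ}
    (hw : 2 ≤ w) :
    ∃ (s : Fin n → ℕ) (a : ℕ → Fin n → ℕ), (∑ i, s i) ≤ w ∧ Conforms a w s ∧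
      ∃ E : Exec A cd a, E.Valid ∧ E.DelayAtLeast w := by
  refine ⟨Pi.single ⟨0, hn⟩ w, _, by simp, conforms_burst _ w, Exec.run A cd _,
    Exec.run_valid _ _ _, ⟨0, hn⟩, 0, ?_⟩
  have := (Exec.run_valid A cd (burst (Pi.single ⟨0, hn⟩ w))).heardCum_le ⟨0, hn⟩ w
  rw [zero_add, zero_add, injCum_burst_one, Pi.single_eq_same]
  omega

/-- There is a constant `c > 0` such that for every algorithm on
`n` nodes and every window size `w ≥ 2` there is a window adversary of window
`w` and an execution in which some packet is delayed by at least
`c · w · max(1, log n / log w)` rounds when `w ≤ n`, and by at least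
`c · (w + n)` rounds when `w > n`. -/
theorem stmt3 :
    ∃ c : ℝ, 0 < c ∧
      ∀ (n : ℕ), 1 ≤ n → ∀ (A : Algo n) (cd : Bool) (w : ℕ), 2 ≤ w →
        ∃ (s : Fin n → ℕ) (a : ℕ → Fin n → ℕ),
          (∑ i, s i) ≤ w ∧ Conforms a w s ∧
          ∃ E : Exec A cd a, E.Valid ∧
            ∃ D : ℕ,
              (if w ≤ n then c * w * max 1 (Real.log n / Real.log w)
                else c * ((w : ℝ) + n)) ≤ (D : ℝ) ∧
              E.DelayAtLeast D := by
  refine ⟨1 / 48, by norm_num, ?_⟩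
  intro n hn A cd w hw
  have hw' : (2 : ℝ) ≤ w := by exact_mod_cast hw
  by_cases hlarge : w ≤ n ∧ 8 ≤ Real.log n / Real.log w
  · obtain ⟨hwn, hL⟩ := hlarge
    have hlogw : 0 < Real.log w := Real.log_pos (by linarith)
    have hm : 1 ≤ w / 2 := by omega
    have hm' : (1 : ℝ) ≤ (w / 2 : ℕ) := by exact_mod_cast hm
    have hwm : (w : ℝ) ≤ 3 * (w / 2 : ℕ) := by exact_mod_cast (by omega : w ≤ 3 * (w / 2))
    set m := w / 2
    set L := Real.log n / Real.log w with hLdef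
    have hmL : (8 : ℝ) ≤ m * L := by nlinarith
    have hfloor : (⌊m * L / 8⌋₊ : ℝ) ≤ m * L / 8 := Nat.floor_le (by linarith)
    have hfloor' : m * L / 8 < ⌊m * L / 8⌋₊ + 1 := Nat.lt_floor_add_one _
    have hone : (1 : ℝ) ≤ ⌊m * L / 8⌋₊ := by
      exact_mod_cast Nat.le_floor (by push_cast; linarith : ((1 : ℕ) : ℝ) ≤ m * L / 8)
    have hlog : Real.log n = L * Real.log w := by
      rw [hLdef, div_mul_cancel₀ _ hlogw.ne']
    have hpow := pow_mul_pow_lt_of_log (t := ⌊m * L / 8⌋₊) hw (by omega : 2 * m ≤ w) hn (by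
      rw [hlog, ← mul_assoc]
      refine mul_lt_mul_of_pos_right ?_ hlogw
      push_cast
      nlinarith)
    obtain ⟨S, hS, hdelay⟩ := exists_burst_delayAtLeast A cd hm (hw.trans hwn) hpow
    refine ⟨_, _, ?_, conforms_burst _ w, burstRun A cd S, Exec.run_valid _ _ _, _, ?_, hdelay⟩
    · simp only [Finset.sum_ite_mem, Finset.univ_inter, Finset.sum_const, smul_eq_mul, mul_one]
      omega
    · rw [if_pos hwn, max_eq_right (by linarith)]
      nlinarith
  · obtain ⟨s, a, hs, ha, E, hE, hdelay⟩ := exists_delayAtLeast_window hn A cd hw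
    refine ⟨s, a, hs, ha, E, hE, w, ?_, hdelay⟩
    split_ifs with hwn
    · have hL : max 1 (Real.log n / Real.log w) ≤ 8 :=
        max_le (by norm_num) (not_le.1 fun h => hlarge ⟨hwn, h⟩).le
      nlinarith
    · have : (n : ℝ) ≤ w := by exact_mod_cast (not_le.1 hwn).le
      linarith
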